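/- Let $V$ be a separable Hilbert space, $H\in(1/2,1)$, and $-\infty\le\alpha<\beta\le\infty$. Let $f(t,x,\theta)$ be a $V$-valued function on $\mathbb{R}\times\mathbb{R}^d\times(\alpha,\beta)$, jointly measurable, which (as a function of $(t,x)$ with values in $L^{1/H}((\alpha,\beta);V)$) is infinitely differentiable with compact support in $\mathbb{R}\times\mathbb{R}^d$. Then $\int_{\mathbb{R}^d}\int_{-\infty}^{\infty}\int_{-\infty}^t\left(\int_\alpha^\beta\|\nabla T_{t-s}f(s,\cdot,\theta)(x)\|^{1/H}\,d\theta\right)^{2H}ds\,dt\,dx\;\le\;N\int_{-\infty}^{\infty}\left[\int_\alpha^\beta\left(\int_{\mathbb{R}^d}\|f(t,x,\theta)\|_V^2\,dx\right)^{1/(2H)}d\theta\right]^{2H}dt,$ where $N$ is a constant depending only on $d$. -/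

import Mathlib

open MeasureTheory ENNReal

/-- The heat kernel `G_t(x) = (4πt)^{-d/2} exp(-|x|²/(4t))` on `ℝ^d`. -/
noncomputable def heatKernel (d : ℕ) (t : ℝ) (x : EuclideanSpace ℝ (Fin d)) : ℝ :=
  (4 * Real.pi * t) ^ (-(d : ℝ)/2) * Real.exp (-‖x‖^2 / (4*t))

/-- The heat semigroup `T_t h (x) = ∫_{ℝ^d} h(x-y) G_t(y) dy` (Bochner integral). -/
noncomputable def heatOp (d : ℕ) {V : Type*} [NormedAddCommGroup V] [NormedSpace ℝ V]
    [CompleteSpace V] (t : ℝ) (h : EuclideanSpace ℝ (Fin d) → V)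
    (x : EuclideanSpace ℝ (Fin d)) : V :=
  ∫ y, heatKernel d t y • h (x - y)

/-- Squared norm of the spatial gradient of `T_t h` at `x`:
`‖∇ T_t h(x)‖² = ∑_{j=1}^d ‖∂_{x_j} T_t h(x)‖²`. -/
noncomputable def gradHeatNormSq (d : ℕ) {V : Type*} [NormedAddCommGroup V]
    [NormedSpace ℝ V] [CompleteSpace V] (t : ℝ) (h : EuclideanSpace ℝ (Fin d) → V)
    (x : EuclideanSpace ℝ (Fin d)) : ℝ :=
  ∑ j : Fin d, ‖fderiv ℝ (heatOp d t h) x (EuclideanSpace.single j 1)‖^2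

theorem lintegral_rpow_le_of_le_lintegral {X Y : Type*} [MeasurableSpace X] [MeasurableSpace Y]
    {μ : Measure X} {ν : Measure Y} [SFinite μ] [SFinite ν] {q : ℝ} (hq : 1 < q)
    {g : X → Y → ℝ≥0∞} (hg : Measurable (Function.uncurry g))
    {φ : X → ℝ≥0∞} (hφ : Measurable φ) (hφg : ∀ x, φ x ≤ ∫⁻ y, g x y ∂ν)
    (hfin : ∫⁻ x, φ x ^ q ∂μ ≠ ∞) :
    ∫⁻ x, φ x ^ q ∂μ ≤ (∫⁻ y, (∫⁻ x, g x y ^ q ∂μ) ^ (1 / q) ∂ν) ^ q := by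
  have hq0 : 0 < q := by linarith
  set R := ∫⁻ y, (∫⁻ x, g x y ^ q ∂μ) ^ (1 / q) ∂ν
  set A := ∫⁻ x, φ x ^ q ∂μ
  have hconj : (Real.conjExponent q).HolderConjugate q :=
    (Real.HolderConjugate.conjExponent hq).symm
  have hφq : Measurable fun x => φ x ^ (q - 1) := hφ.pow_const _
  have key : A ≤ A ^ (1 / Real.conjExponent q) * R := by
    calc A ≤ ∫⁻ x, ∫⁻ y, φ x ^ (q - 1) * g x y ∂ν ∂μ := by
            refine lintegral_mono fun x => ?_
            rw [lintegral_const_mul _ hg.of_uncurry_left]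
            calc φ x ^ q = φ x ^ (q - 1) * φ x := by
                  conv_rhs => rw [← ENNReal.rpow_one (φ x), ← ENNReal.rpow_mul,
                    ← ENNReal.rpow_add_of_nonneg _ _ (by linarith) zero_le_one]
                  congr 1; ring
              _ ≤ _ := by gcongr; exact hφg x
      _ = ∫⁻ y, ∫⁻ x, φ x ^ (q - 1) * g x y ∂μ ∂ν :=
            lintegral_lintegral_swap ((hφq.comp measurable_fst).mul hg).aemeasurable
      _ ≤ ∫⁻ y, A ^ (1 / Real.conjExponent q) * (∫⁻ x, g x y ^ q ∂μ) ^ (1 / q) ∂ν := by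
            refine lintegral_mono fun y => ?_
            refine (ENNReal.lintegral_mul_le_Lp_mul_Lq μ hconj hφq.aemeasurable
              (hg.of_uncurry_right (y := y)).aemeasurable).trans ?_
            have he : ∀ x, (φ x ^ (q - 1)) ^ Real.conjExponent q = φ x ^ q := fun x => by
              rw [← ENNReal.rpow_mul, Real.conjExponent, mul_div_cancel₀ _ (by linarith)]
            simp_rw [he]
            rfl
      _ = _ := by
            rw [lintegral_const_mul]
            exact (Measurable.lintegral_prod_left' (f := fun p : X × Y => g p.1 p.2 ^ q)
              (hg.pow_const _)).pow_const _
  by_cases hA0 : A = 0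
  · rw [hA0]; exact zero_le
  have h1 : A ^ (1 / q) ≤ R := by
    have hne0 : A ^ (1 / Real.conjExponent q) ≠ 0 := by simp [hA0, hfin]
    have hnetop : A ^ (1 / Real.conjExponent q) ≠ ∞ := by simp [hA0, hfin]
    rw [← ENNReal.mul_le_mul_iff_right hne0 hnetop]
    refine le_trans (le_of_eq ?_) key
    rw [← ENNReal.rpow_add _ _ hA0 hfin, one_div, one_div, hconj.inv_add_inv_eq_one,
      ENNReal.rpow_one]
  calc A = (A ^ (1 / q)) ^ q := by rw [← ENNReal.rpow_mul]; field_simp; simp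
    _ ≤ R ^ q := by gcongr

/-- **Minkowski's integral inequality** for nonnegative functions. -/
theorem lintegral_rpow_lintegral_le {X Y : Type*} [MeasurableSpace X] [MeasurableSpace Y]
    {μ : Measure X} {ν : Measure Y} [SigmaFinite μ] [SFinite ν] {q : ℝ} (hq : 1 < q)
    {g : X → Y → ℝ≥0∞} (hg : Measurable (Function.uncurry g)) :
    ∫⁻ x, (∫⁻ y, g x y ∂ν) ^ q ∂μ ≤ (∫⁻ y, (∫⁻ x, g x y ^ q ∂μ) ^ (1 / q) ∂ν) ^ q := by
  have hq0 : 0 < q := by linarith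
  set F : X → ℝ≥0∞ := fun x => ∫⁻ y, g x y ∂ν
  have hFm : Measurable F := hg.lintegral_prod_right'
  set φ : ℕ → X → ℝ≥0∞ := fun n => (spanningSets μ n).indicator fun x => min (F x) n with hφ
  have hφm : ∀ n, Measurable (φ n) := fun n =>
    (hFm.min measurable_const).indicator (measurableSet_spanningSets μ n)
  have hmono : Monotone φ := by
    intro m n hmn x
    refine (Set.indicator_le_indicator_apply_of_subset (monotone_spanningSets μ hmn)
      zero_le).trans ?_
    refine Set.indicator_le_indicator ?_
    gcongr
  have hsup : ∀ x, ⨆ n, φ n x ^ q = F x ^ q := by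
    intro x
    refine le_antisymm (iSup_le fun n => ?_) ?_
    · gcongr
      exact (Set.indicator_le_self _ _ x).trans (min_le_left _ _)
    · obtain ⟨k, hk⟩ : ∃ k, x ∈ spanningSets μ k :=
        ⟨_, mem_spanningSetsIndex μ x⟩
      have : Filter.Tendsto (fun n => φ n x ^ q) Filter.atTop (nhds (F x ^ q)) := by
        apply Filter.Tendsto.ennrpow_const
        have h2 : Filter.Tendsto (fun n : ℕ => min (F x) n) Filter.atTop (nhds (min (F x) ∞)) :=
          tendsto_const_nhds.min ENNReal.tendsto_nat_nhds_top
        rw [min_eq_left le_top] at h2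
        refine h2.congr' ?_
        filter_upwards [Filter.eventually_ge_atTop k] with n hn
        simp only [hφ]
        rw [Set.indicator_of_mem (monotone_spanningSets μ hn hk)]
      exact le_of_tendsto' this fun n => le_iSup (fun n => φ n x ^ q) n
  calc ∫⁻ x, F x ^ q ∂μ = ⨆ n, ∫⁻ x, φ n x ^ q ∂μ := by
        rw [← lintegral_iSup (fun n => (hφm n).pow_const q)]
        · simp_rw [hsup]
        · intro m n hmn x
          exact ENNReal.rpow_le_rpow (hmono hmn x) hq0.le
    _ ≤ _ := by
        refine iSup_le fun n => lintegral_rpow_le_of_le_lintegral hq hg (hφm n) (fun x =>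
          (Set.indicator_le_self _ _ x).trans (min_le_left _ _)) ?_
        refine ((lintegral_mono (g := (spanningSets μ n).indicator fun _ => (n : ℝ≥0∞) ^ q)
          fun x => ?_).trans_lt ?_).ne
        · simp only [hφ, Set.indicator]
          split_ifs
          · gcongr; exact min_le_right _ _
          · simp [hq0]
        · rw [lintegral_indicator_const (measurableSet_spanningSets μ n)]
          exact ENNReal.mul_lt_top
            (ENNReal.rpow_lt_top_of_nonneg hq0.le (ENNReal.natCast_ne_top n))
            (measure_spanningSets_lt_top μ n)

lemma mul_exp_neg_mul_le {c : ℝ} (hc : 0 < c) (r : ℝ) :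
    r * Real.exp (-c * r) ≤ 1 / c := by
  have h := Real.add_one_le_exp (c * r)
  rw [show -c * r = -(c * r) by ring, Real.exp_neg, ← div_eq_mul_inv, div_le_div_iff₀
    (Real.exp_pos _) hc]
  linarith

lemma mul_exp_neg_mul_sq_le {c r : ℝ} (hc : 0 < c) :
    r * Real.exp (-c * r ^ 2) ≤ 1 + 1 / c := by
  have h1 := mul_exp_neg_mul_le hc (r ^ 2)
  have h2 : Real.exp (-c * r ^ 2) ≤ 1 := Real.exp_le_one_iff.2 (by nlinarith [sq_nonneg r])
  have h3 := Real.exp_pos (-c * r ^ 2)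
  have h4 : r ≤ 1 + r ^ 2 := by nlinarith [sq_nonneg (r - 1), sq_nonneg (r+1)]
  nlinarith

section Gaussian

variable {E : Type*} [NormedAddCommGroup E] [InnerProductSpace ℝ E] [FiniteDimensional ℝ E]
  [MeasurableSpace E] [BorelSpace E]

lemma integrable_exp_neg_mul_sq_norm {b : ℝ} (hb : 0 < b) :
    Integrable (fun w : E => Real.exp (-b * ‖w‖ ^ 2)) := by
  have h := (GaussianFourier.integrable_cexp_neg_mul_sq_norm_add (V := E) (b := (b : ℂ))
    (by simpa using hb) 0 0).re
  refine h.congr (Filter.Eventually.of_forall fun w => ?_)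
  have h2 : -(b : ℂ) * (‖w‖ : ℂ) ^ 2 + 0 * ((inner ℝ (0 : E) w : ℝ) : ℂ) =
      ((-b * ‖w‖ ^ 2 : ℝ) : ℂ) := by
    push_cast; ring
  beta_reduce
  rw [h2]
  exact Complex.exp_ofReal_re _

lemma integrable_sq_norm_mul_exp_neg_mul_sq_norm {b : ℝ} (hb : 0 < b) :
    Integrable (fun w : E => ‖w‖ ^ 2 * Real.exp (-b * ‖w‖ ^ 2)) := by
  refine ((integrable_exp_neg_mul_sq_norm (E := E) (half_pos hb)).const_mul (1 / (b / 2))).mono'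
    (by fun_prop) (Filter.Eventually.of_forall fun w => ?_)
  rw [Real.norm_of_nonneg (by positivity)]
  have h := mul_exp_neg_mul_le (half_pos hb) (‖w‖ ^ 2)
  rw [show -b * ‖w‖ ^ 2 = -(b / 2) * ‖w‖ ^ 2 + -(b / 2) * ‖w‖ ^ 2 by ring, Real.exp_add,
    ← mul_assoc]
  gcongr

lemma integral_sq_norm_mul_exp_neg_mul_sq_norm {b : ℝ} (hb : 0 < b) :
    ∫ w : E, ‖w‖ ^ 2 * Real.exp (-b * ‖w‖ ^ 2) =
      Module.finrank ℝ E / (2 * b) * (Real.pi / b) ^ (Module.finrank ℝ E / 2 : ℝ) := by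
  have h1 : HasDerivAt (fun c : ℝ => ∫ w : E, Real.exp (-c * ‖w‖ ^ 2))
      (∫ w : E, -(‖w‖ ^ 2 * Real.exp (-b * ‖w‖ ^ 2))) b := by
    refine (hasDerivAt_integral_of_dominated_loc_of_deriv_le (𝕜 := ℝ)
      (F := fun c (w : E) => Real.exp (-c * ‖w‖ ^ 2))
      (F' := fun c (w : E) => -(‖w‖ ^ 2 * Real.exp (-c * ‖w‖ ^ 2)))
      (bound := fun w => ‖w‖ ^ 2 * Real.exp (-(b / 2) * ‖w‖ ^ 2))
      (Ioi_mem_nhds (half_lt_self hb)) (Filter.Eventually.of_forall fun c => by fun_prop)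
      (integrable_exp_neg_mul_sq_norm hb) (by fun_prop)
      (Filter.Eventually.of_forall fun w c hc => ?_)
      (integrable_sq_norm_mul_exp_neg_mul_sq_norm (half_pos hb))
      (Filter.Eventually.of_forall fun w c hc => ?_)).2
    · rw [norm_neg, Real.norm_of_nonneg (by positivity)]
      gcongr
      exact le_of_lt hc
    · exact (((hasDerivAt_neg c).mul_const (‖w‖ ^ 2)).exp).congr_deriv (by ring)
  have h2 : HasDerivAt (fun c : ℝ => ∫ w : E, Real.exp (-c * ‖w‖ ^ 2))
      (-(Module.finrank ℝ E / (2 * b) * (Real.pi / b) ^ (Module.finrank ℝ E / 2 : ℝ))) b := by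
    have h3 : HasDerivAt (fun c : ℝ => (Real.pi / c) ^ (Module.finrank ℝ E / 2 : ℝ))
        (-(Module.finrank ℝ E / (2 * b) * (Real.pi / b) ^ (Module.finrank ℝ E / 2 : ℝ))) b := by
      have hpos : 0 < Real.pi / b := by positivity
      have h := ((hasDerivAt_inv hb.ne').const_mul Real.pi).rpow_const
        (p := (Module.finrank ℝ E / 2 : ℝ)) (Or.inl (by positivity))
      simp only [← div_eq_mul_inv] at h
      refine h.congr_deriv ?_
      rw [Real.rpow_sub_one hpos.ne']
      field_simp
    refine h3.congr_of_eventuallyEq ?_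
    filter_upwards [Ioi_mem_nhds hb] with c hc
    exact GaussianFourier.integral_rexp_neg_mul_sq_norm hc
  have h3 := h1.unique h2
  rw [integral_neg] at h3
  linarith

end Gaussian

section HeatKernel

variable {d : ℕ}

local notation "𝔼" => EuclideanSpace ℝ (Fin d)

lemma heatKernel_eq (t : ℝ) (x : 𝔼) :
    heatKernel d t x = (4 * Real.pi * t) ^ (-(d : ℝ)/2) * Real.exp (-(1 / (4 * t)) * ‖x‖ ^ 2) := by
  unfold heatKernel; congr 2; ring

lemma heatKernel_nonneg {t : ℝ} (ht : 0 < t) (x : 𝔼) : 0 ≤ heatKernel d t x := by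
  unfold heatKernel; positivity

lemma heatKernel_neg (t : ℝ) (x : 𝔼) : heatKernel d t (-x) = heatKernel d t x := by
  simp [heatKernel]

@[fun_prop]
lemma continuous_heatKernel (t : ℝ) : Continuous (heatKernel d t) := by
  unfold heatKernel; fun_prop

lemma measurable_heatKernel : Measurable fun p : ℝ × 𝔼 => heatKernel d p.1 p.2 := by
  unfold heatKernel; fun_prop

lemma heatKernel_le {t : ℝ} (ht : 0 < t) (x : 𝔼) :
    heatKernel d t x ≤ (4 * Real.pi * t) ^ (-(d : ℝ)/2) := by
  unfold heatKernel
  refine mul_le_of_le_one_right (by positivity) (Real.exp_le_one_iff.2 ?_)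
  rw [neg_div, neg_nonpos]; positivity

lemma integrable_heatKernel {t : ℝ} (ht : 0 < t) : Integrable (heatKernel d t) := by
  simp_rw [funext (heatKernel_eq (d := d) t)]
  exact (integrable_exp_neg_mul_sq_norm (by positivity)).const_mul _

lemma integral_heatKernel {t : ℝ} (ht : 0 < t) : ∫ x, heatKernel d t x = 1 := by
  simp_rw [heatKernel_eq]
  rw [integral_const_mul, GaussianFourier.integral_rexp_neg_mul_sq_norm (by positivity),
    finrank_euclideanSpace_fin, show Real.pi / (1 / (4 * t)) = 4 * Real.pi * t by field_simp,
    ← Real.rpow_add (by positivity)]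
  ring_nf; simp

/-- The partial derivative `∂_j G_t` of the heat kernel. -/
noncomputable def heatKernelDeriv (t : ℝ) (j : Fin d) (w : 𝔼) : ℝ :=
  -(heatKernel d t w / (2 * t)) * w j

@[fun_prop]
lemma continuous_heatKernelDeriv (t : ℝ) (j : Fin d) : Continuous (heatKernelDeriv t j) := by
  unfold heatKernelDeriv; fun_prop

lemma measurable_heatKernelDeriv (j : Fin d) :
    Measurable fun p : ℝ × 𝔼 => heatKernelDeriv p.1 j p.2 := by
  unfold heatKernelDeriv
  have := measurable_heatKernel (d := d)
  fun_prop

lemma norm_mul_heatKernel_le {t : ℝ} (ht : 0 < t) (w : 𝔼) :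
    heatKernel d t w * ‖w‖ ≤ (4 * Real.pi * t) ^ (-(d : ℝ)/2) * (1 + 1 / (1 / (8 * t))) *
      Real.exp (-(1 / (8 * t)) * ‖w‖ ^ 2) := by
  have h := mul_exp_neg_mul_sq_le (c := 1 / (8 * t)) (r := ‖w‖) (by positivity)
  rw [heatKernel_eq, show -(1 / (4 * t)) * ‖w‖ ^ 2 =
    -(1 / (8 * t)) * ‖w‖ ^ 2 + -(1 / (8 * t)) * ‖w‖ ^ 2 by field_simp; ring, Real.exp_add]
  have h2 : (0:ℝ) ≤ (4 * Real.pi * t) ^ (-(d : ℝ)/2) := by positivity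
  have := mul_le_mul_of_nonneg_right (mul_le_mul_of_nonneg_left h h2)
    (Real.exp_pos (-(1 / (8 * t)) * ‖w‖ ^ 2)).le
  linarith

lemma norm_mul_heatKernel_le_const {t : ℝ} (ht : 0 < t) (w : 𝔼) :
    heatKernel d t w * ‖w‖ ≤ (4 * Real.pi * t) ^ (-(d : ℝ)/2) * (1 + 1 / (1 / (8 * t))) := by
  refine (norm_mul_heatKernel_le ht w).trans (mul_le_of_le_one_right (by positivity)
    (Real.exp_le_one_iff.2 ?_))
  rw [neg_mul, neg_nonpos]; positivity

lemma abs_heatKernelDeriv_le {t : ℝ} (ht : 0 < t) (j : Fin d) (w : 𝔼) :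
    |heatKernelDeriv t j w| ≤ heatKernel d t w * ‖w‖ / (2 * t) := by
  rw [heatKernelDeriv, abs_mul, abs_neg, abs_of_nonneg
    (div_nonneg (heatKernel_nonneg ht w) (by positivity)), div_mul_eq_mul_div]
  have := heatKernel_nonneg ht w
  have h2 : |w j| ≤ ‖w‖ := PiLp.norm_apply_le w j
  gcongr

lemma integrable_heatKernelDeriv {t : ℝ} (ht : 0 < t) (j : Fin d) :
    Integrable (heatKernelDeriv t j) := by
  refine (((integrable_exp_neg_mul_sq_norm (E := 𝔼) (b := 1 / (8 * t)) (by positivity)).const_mul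
    ((4 * Real.pi * t) ^ (-(d : ℝ)/2) * (1 + 1 / (1 / (8 * t))))).div_const (2 * t)).mono'
    (by fun_prop) (Filter.Eventually.of_forall fun w => ?_)
  refine (abs_heatKernelDeriv_le ht j w).trans ?_
  exact div_le_div_of_nonneg_right (norm_mul_heatKernel_le ht w) (by positivity)

lemma hasFDerivAt_heatKernel {t : ℝ} (w : 𝔼) :
    HasFDerivAt (heatKernel d t) (-(heatKernel d t w / (2 * t)) • innerSL ℝ w) w := by
  have h := (((hasStrictFDerivAt_norm_sq w).hasFDerivAt.const_mul (-(1 / (4 * t)))).exp).const_mul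
    ((4 * Real.pi * t) ^ (-(d : ℝ)/2))
  rw [funext (heatKernel_eq (d := d) t)]
  refine h.congr_fderiv ?_
  ext v
  simp
  ring

/-- The kernel `∫ ∇G_t(x - y) · ∇G_t(x - z) dx = -ΔG_{2t}(y - z)`. -/
lemma sum_integral_heatKernelDeriv_mul {t : ℝ} (ht : 0 < t) (y z : 𝔼) :
    ∑ j, ∫ x, heatKernelDeriv t j (x - y) * heatKernelDeriv t j (x - z) =
      (d / (4 * t) - ‖y - z‖ ^ 2 / (16 * t ^ 2)) * heatKernel d (2 * t) (y - z) := by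
  have hint : ∀ j, Integrable fun x =>
      heatKernelDeriv t j (x - y) * heatKernelDeriv t j (x - z) := by
    intro j
    refine ((integrable_heatKernelDeriv ht j).comp_sub_right z).bdd_mul
      (c := (4 * Real.pi * t) ^ (-(d : ℝ)/2) * (1 + 1 / (1 / (8 * t))) / (2 * t)) (by fun_prop)
      (Filter.Eventually.of_forall fun x => ?_)
    refine (abs_heatKernelDeriv_le ht j _).trans ?_
    exact div_le_div_of_nonneg_right (norm_mul_heatKernel_le_const ht _) (by positivity)
  rw [← integral_finsetSum _ fun j _ => hint j]
  set u : 𝔼 := (1 / 2 : ℝ) • (z - y) with hu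
  have hyz : y - z = -((2 : ℝ) • u) := by
    rw [hu, smul_smul]; norm_num
  clear_value u
  rw [← integral_add_right_eq_self _ ((1 / 2 : ℝ) • (y + z))]
  have hpt : ∀ w : 𝔼, (∑ j, heatKernelDeriv t j (w + (1 / 2 : ℝ) • (y + z) - y) *
      heatKernelDeriv t j (w + (1 / 2 : ℝ) • (y + z) - z)) =
      ((4 * Real.pi * t) ^ (-(d : ℝ)/2)) ^ 2 / (4 * t ^ 2) * Real.exp (-(1 / (2 * t)) * ‖u‖ ^ 2) *
      (‖w‖ ^ 2 * Real.exp (-(1 / (2 * t)) * ‖w‖ ^ 2) -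
        ‖u‖ ^ 2 * Real.exp (-(1 / (2 * t)) * ‖w‖ ^ 2)) := by
    intro w
    have e1 : w + (1 / 2 : ℝ) • (y + z) - y = w + u := by rw [hu]; module
    have e2 : w + (1 / 2 : ℝ) • (y + z) - z = w - u := by rw [hu]; module
    rw [e1, e2]
    have hin : ∑ j, (w + u) j * (w - u) j = ‖w‖ ^ 2 - ‖u‖ ^ 2 := by
      rw [EuclideanSpace.norm_sq_eq, EuclideanSpace.norm_sq_eq, ← Finset.sum_sub_distrib]
      refine Finset.sum_congr rfl fun j _ => ?_
      simp; ring
    have hexp : Real.exp (-(1 / (4 * t)) * ‖w + u‖ ^ 2) * Real.exp (-(1 / (4 * t)) * ‖w - u‖ ^ 2) =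
        Real.exp (-(1 / (2 * t)) * ‖u‖ ^ 2) * Real.exp (-(1 / (2 * t)) * ‖w‖ ^ 2) := by
      rw [← Real.exp_add, ← Real.exp_add]
      congr 1
      rw [@norm_add_sq_real, @norm_sub_sq_real]
      field_simp; ring
    simp_rw [heatKernelDeriv, heatKernel_eq]
    calc _ = ((4 * Real.pi * t) ^ (-(d : ℝ)/2)) ^ 2 / (4 * t ^ 2) *
          (Real.exp (-(1 / (4 * t)) * ‖w + u‖ ^ 2) * Real.exp (-(1 / (4 * t)) * ‖w - u‖ ^ 2)) *
          ∑ j, (w + u) j * (w - u) j := by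
            rw [Finset.mul_sum]
            refine Finset.sum_congr rfl fun j _ => ?_
            field_simp; ring
      _ = _ := by rw [hin, hexp]; ring
  simp_rw [hpt]
  have hb : 0 < 1 / (2 * t) := by positivity
  rw [integral_const_mul, integral_sub (integrable_sq_norm_mul_exp_neg_mul_sq_norm hb)
    ((integrable_exp_neg_mul_sq_norm hb).const_mul _), integral_const_mul,
    integral_sq_norm_mul_exp_neg_mul_sq_norm hb, GaussianFourier.integral_rexp_neg_mul_sq_norm hb,
    finrank_euclideanSpace_fin, hyz, norm_neg, norm_smul, heatKernel_eq, norm_neg, norm_smul]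
  have hc : ((4 * Real.pi * t) ^ (-(d : ℝ)/2)) ^ 2 * (Real.pi / (1 / (2 * t))) ^ ((d : ℝ) / 2) =
      (4 * Real.pi * (2 * t)) ^ (-(d : ℝ)/2) := by
    have h1 : Real.pi / (1 / (2 * t)) = 2 * Real.pi * t := by field_simp
    rw [h1, sq, ← Real.mul_rpow (by positivity) (by positivity),
      show (d : ℝ) / 2 = -(-(d : ℝ) / 2) by ring, Real.rpow_neg (by positivity),
      ← div_eq_mul_inv, ← Real.div_rpow (by positivity) (by positivity)]
    congr 1
    field_simp; ring
  have he : -(1 / (4 * (2 * t))) * (‖(2:ℝ)‖ * ‖u‖) ^ 2 = -(1 / (2 * t)) * ‖u‖ ^ 2 := by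
    norm_num; field_simp; ring
  rw [he, ← hc]
  norm_num
  field_simp
  ring

variable {V : Type*} [NormedAddCommGroup V] [InnerProductSpace ℝ V]

lemma hasFDerivAt_heatOp [CompleteSpace V] {t : ℝ} (ht : 0 < t) {h : 𝔼 → V} (hh : Integrable h)
    (x : 𝔼) : HasFDerivAt (heatOp d t h)
      (∫ y, (-(heatKernel d t (x - y) / (2 * t)) • innerSL ℝ (x - y)).smulRight (h y)) x := by
  set C := (4 * Real.pi * t) ^ (-(d : ℝ)/2) * (1 + 1 / (1 / (8 * t))) / (2 * t)
  have heq : heatOp d t h = fun x => ∫ y, heatKernel d t (x - y) • h y := by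
    ext x
    rw [heatOp, ← integral_sub_left_eq_self _ _ x]
    simp
  rw [heq]
  refine hasFDerivAt_integral_of_dominated_of_fderiv_le (𝕜 := ℝ)
    (F := fun x y => heatKernel d t (x - y) • h y)
    (F' := fun x y => (-(heatKernel d t (x - y) / (2 * t)) • innerSL ℝ (x - y)).smulRight (h y))
    (bound := fun y => C * ‖h y‖) Filter.univ_mem (Filter.Eventually.of_forall fun x => ?_) ?_ ?_
    (Filter.Eventually.of_forall fun y x _ => ?_) (hh.norm.const_mul _)
    (Filter.Eventually.of_forall fun y x _ => ?_)
  · exact (Continuous.aestronglyMeasurable (by fun_prop)).smul hh.1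
  · exact hh.bdd_smul _ (Continuous.aestronglyMeasurable (by fun_prop))
      (Filter.Eventually.of_forall fun y => by
        rw [Real.norm_of_nonneg (heatKernel_nonneg ht _)]; exact heatKernel_le ht _)
  · exact (ContinuousLinearMap.smulRightL ℝ 𝔼 V).aestronglyMeasurable_comp₂
      (Continuous.aestronglyMeasurable (by fun_prop)) hh.1
  · rw [ContinuousLinearMap.norm_smulRight_apply, norm_smul, innerSL_apply_norm, norm_neg,
      Real.norm_of_nonneg (div_nonneg (heatKernel_nonneg ht _) (by positivity)),
      div_mul_eq_mul_div]
    exact mul_le_mul_of_nonneg_right (div_le_div_of_nonneg_right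
      (norm_mul_heatKernel_le_const ht _) (by positivity)) (norm_nonneg _)
  · exact ((hasFDerivAt_heatKernel (x - y)).comp x ((hasFDerivAt_id x).sub_const y)).smul_const
      (h y)

lemma abs_heatKernelDeriv_le_const {t : ℝ} (ht : 0 < t) (j : Fin d) (w : 𝔼) :
    |heatKernelDeriv t j w| ≤
      (4 * Real.pi * t) ^ (-(d : ℝ)/2) * (1 + 1 / (1 / (8 * t))) / (2 * t) :=
  (abs_heatKernelDeriv_le ht j w).trans
    (div_le_div_of_nonneg_right (norm_mul_heatKernel_le_const ht _) (by positivity))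

lemma fderiv_heatOp_single [CompleteSpace V] {t : ℝ} (ht : 0 < t) {h : 𝔼 → V} (hh : Integrable h)
    (x : 𝔼) (j : Fin d) : fderiv ℝ (heatOp d t h) x (EuclideanSpace.single j 1) =
      ∫ y, heatKernelDeriv t j (x - y) • h y := by
  rw [(hasFDerivAt_heatOp ht hh x).fderiv, ContinuousLinearMap.integral_apply]
  · simp [heatKernelDeriv, EuclideanSpace.inner_single_right]
  · refine (hh.norm.const_mul ((4 * Real.pi * t) ^ (-(d : ℝ)/2) * (1 + 1 / (1 / (8 * t))) /
      (2 * t))).mono' ((ContinuousLinearMap.smulRightL ℝ 𝔼 V).aestronglyMeasurable_comp₂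
      (Continuous.aestronglyMeasurable (by fun_prop)) hh.1)
      (Filter.Eventually.of_forall fun y => ?_)
    rw [ContinuousLinearMap.norm_smulRight_apply, norm_smul, innerSL_apply_norm, norm_neg,
      Real.norm_of_nonneg (div_nonneg (heatKernel_nonneg ht _) (by positivity)),
      div_mul_eq_mul_div]
    exact mul_le_mul_of_nonneg_right (div_le_div_of_nonneg_right
      (norm_mul_heatKernel_le_const ht _) (by positivity)) (norm_nonneg _)

section ConvolutionSquare

variable {k : EuclideanSpace ℝ (Fin d) → ℝ} {M : ℝ} {h : EuclideanSpace ℝ (Fin d) → V}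

lemma integrable_inner_prod (hh : Integrable h) :
    Integrable fun p : 𝔼 × 𝔼 => inner ℝ (h p.1) (h p.2) := by
  refine (hh.norm.mul_prod hh.norm).mono' (hh.1.comp_fst.inner hh.1.comp_snd)
    (Filter.Eventually.of_forall fun p => norm_inner_le_norm _ _)

lemma integrable_kernel_mul_inner (hkc : Continuous k) (hk : Integrable k) (hkM : ∀ w, |k w| ≤ M)
    (hh : Integrable h) :
    Integrable fun q : 𝔼 × (𝔼 × 𝔼) =>
      k (q.1 - q.2.1) * k (q.1 - q.2.2) * inner ℝ (h q.2.1) (h q.2.2) := by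
  have hm : AEStronglyMeasurable (fun q : 𝔼 × (𝔼 × 𝔼) =>
      k (q.1 - q.2.1) * k (q.1 - q.2.2) * inner ℝ (h q.2.1) (h q.2.2)) :=
    (Continuous.aestronglyMeasurable (by fun_prop)).mul (integrable_inner_prod hh).1.comp_snd
  have hkk : ∀ p : 𝔼 × 𝔼, Integrable fun x => k (x - p.1) * k (x - p.2) := fun p =>
    (hk.comp_sub_right p.2).bdd_mul (c := M) (by fun_prop)
      (Filter.Eventually.of_forall fun x => hkM _)
  refine (integrable_prod_iff' hm).2 ⟨Filter.Eventually.of_forall fun p =>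
    (hkk p).mul_const (inner ℝ (h p.1) (h p.2)), ?_⟩
  refine ((integrable_inner_prod hh).norm.const_mul (M * ∫ w, |k w|)).mono'
    hm.norm.prod_swap.integral_prod_right' (Filter.Eventually.of_forall fun p => ?_)
  rw [Real.norm_of_nonneg (integral_nonneg fun x => norm_nonneg _)]
  simp_rw [norm_mul]
  rw [integral_mul_const]
  refine mul_le_mul_of_nonneg_right ?_ (norm_nonneg _)
  rw [← integral_sub_right_eq_self (fun w => |k w|) p.2, ← integral_const_mul]
  refine integral_mono ?_ ((hk.comp_sub_right p.2).abs.const_mul M) fun x => ?_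
  · simpa only [norm_mul] using (hkk p).norm
  · exact mul_le_mul_of_nonneg_right (hkM _) (abs_nonneg _)

lemma norm_sq_integral_kernel_smul [CompleteSpace V] (hkc : Continuous k) (hk : Integrable k)
    (hkM : ∀ w, |k w| ≤ M) (hh : Integrable h) :
    ∀ᵐ x : 𝔼, ‖∫ y, k (x - y) • h y‖ ^ 2 = ∫ p : 𝔼 × 𝔼,
      k (x - p.1) * k (x - p.2) * inner ℝ (h p.1) (h p.2) := by
  filter_upwards [(integrable_kernel_mul_inner hkc hk hkM hh).prod_right_ae] with x hx
  have hi : Integrable fun y => k (x - y) • h y :=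
    hh.bdd_smul M (Continuous.aestronglyMeasurable (by fun_prop))
      (Filter.Eventually.of_forall fun y => hkM _)
  rw [Measure.volume_eq_prod, integral_prod _ hx, ← real_inner_self_eq_norm_sq, ← integral_inner hi]
  refine integral_congr_ae (Filter.Eventually.of_forall fun z => ?_)
  beta_reduce
  rw [real_inner_comm, ← integral_inner hi]
  refine integral_congr_ae (Filter.Eventually.of_forall fun y => ?_)
  simp [inner_smul_left, inner_smul_right]
  ring

lemma integrable_norm_sq_integral_kernel_smul [CompleteSpace V] (hkc : Continuous k)
    (hk : Integrable k) (hkM : ∀ w, |k w| ≤ M) (hh : Integrable h) :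
    Integrable fun x : 𝔼 => ‖∫ y, k (x - y) • h y‖ ^ 2 :=
  (integrable_kernel_mul_inner hkc hk hkM hh).integral_prod_left.congr
    ((norm_sq_integral_kernel_smul hkc hk hkM hh).mono fun _ hx => hx.symm)

lemma integrable_integral_kernel_mul_inner (hkc : Continuous k)
    (hk : Integrable k) (hkM : ∀ w, |k w| ≤ M) (hh : Integrable h) :
    Integrable fun p : 𝔼 × 𝔼 =>
      (∫ x, k (x - p.1) * k (x - p.2)) * inner ℝ (h p.1) (h p.2) := by
  have := (integrable_kernel_mul_inner hkc hk hkM hh).integral_prod_right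
  simpa only [integral_mul_const] using this

lemma integral_norm_sq_integral_kernel_smul [CompleteSpace V] (hkc : Continuous k)
    (hk : Integrable k) (hkM : ∀ w, |k w| ≤ M) (hh : Integrable h) :
    ∫ x : 𝔼, ‖∫ y, k (x - y) • h y‖ ^ 2 = ∫ p : 𝔼 × 𝔼,
      (∫ x, k (x - p.1) * k (x - p.2)) * inner ℝ (h p.1) (h p.2) := by
  rw [integral_congr_ae (norm_sq_integral_kernel_smul hkc hk hkM hh),
    integral_integral_swap (integrable_kernel_mul_inner hkc hk hkM hh)]
  simp only [integral_mul_const]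

end ConvolutionSquare

/-- `‖∇T_t h(x)‖²`, written with the derivative falling on the heat kernel. -/
noncomputable def heatGradSq (t : ℝ) (h : 𝔼 → V) (x : 𝔼) : ℝ :=
  ∑ j : Fin d, ‖∫ y, heatKernelDeriv t j (x - y) • h y‖ ^ 2

lemma heatGradSq_nonneg (t : ℝ) (h : 𝔼 → V) (x : 𝔼) : 0 ≤ heatGradSq t h x :=
  Finset.sum_nonneg fun _ _ => sq_nonneg _

lemma gradHeatNormSq_eq [CompleteSpace V] {t : ℝ} (ht : 0 < t) {h : 𝔼 → V} (hh : Integrable h)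
    (x : 𝔼) : gradHeatNormSq d t h x = heatGradSq t h x := by
  simp only [gradHeatNormSq, heatGradSq, fderiv_heatOp_single ht hh]

lemma integrable_heatGradSq [CompleteSpace V] {t : ℝ} (ht : 0 < t) {h : 𝔼 → V}
    (hh : Integrable h) : Integrable (heatGradSq t h) :=
  integrable_finsetSum _ fun j _ => integrable_norm_sq_integral_kernel_smul (by fun_prop)
    (integrable_heatKernelDeriv ht j) (abs_heatKernelDeriv_le_const ht j) hh

lemma integral_heatGradSq [CompleteSpace V] {t : ℝ} (ht : 0 < t) {h : 𝔼 → V} (hh : Integrable h) :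
    ∫ x, heatGradSq t h x = ∫ p : 𝔼 × 𝔼,
      (d / (4 * t) - ‖p.1 - p.2‖ ^ 2 / (16 * t ^ 2)) * heatKernel d (2 * t) (p.1 - p.2) *
        inner ℝ (h p.1) (h p.2) := by
  have hb := abs_heatKernelDeriv_le_const (d := d) ht
  have hk := integrable_heatKernelDeriv (d := d) ht
  unfold heatGradSq
  rw [integral_finsetSum _ fun j _ => integrable_norm_sq_integral_kernel_smul (by fun_prop)
    (hk j) (hb j) hh]
  simp_rw [fun j => integral_norm_sq_integral_kernel_smul (by fun_prop) (hk j) (hb j) hh]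
  rw [← integral_finsetSum _ fun j _ => integrable_integral_kernel_mul_inner (by fun_prop)
    (hk j) (hb j) hh]
  simp_rw [← Finset.sum_mul, sum_integral_heatKernelDeriv_mul ht]

lemma hasDerivAt_heatKernel_two_mul {t : ℝ} (ht : 0 < t) (w : 𝔼) :
    HasDerivAt (fun t => heatKernel d (2 * t) w)
      (-2 * ((d / (4 * t) - ‖w‖ ^ 2 / (16 * t ^ 2)) * heatKernel d (2 * t) w)) t := by
  have h1 : HasDerivAt (fun t : ℝ => (4 * Real.pi * (2 * t)) ^ (-(d : ℝ)/2))
      (-(d / (2 * t)) * (4 * Real.pi * (2 * t)) ^ (-(d : ℝ)/2)) t := by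
    have hpos : 0 < 4 * Real.pi * (2 * t) := by positivity
    have h := (((hasDerivAt_id t).const_mul 2).const_mul (4 * Real.pi)).rpow_const
      (p := -(d : ℝ)/2) (Or.inl hpos.ne')
    refine h.congr_deriv ?_
    simp only [id]
    rw [Real.rpow_sub_one hpos.ne']
    field_simp
  have h2 : HasDerivAt (fun t : ℝ => Real.exp (-‖w‖ ^ 2 / (4 * (2 * t))))
      (Real.exp (-‖w‖ ^ 2 / (4 * (2 * t))) * (‖w‖ ^ 2 / (8 * t ^ 2))) t := by
    have h := ((hasDerivAt_const t (-‖w‖ ^ 2)).div (((hasDerivAt_id t).const_mul 2).const_mul 4)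
      (by simp only [id]; positivity)).exp
    refine h.congr_deriv ?_
    simp only [id, Pi.div_apply]
    field_simp
    ring
  refine (h1.mul h2).congr_deriv ?_
  simp only [heatKernel]
  field_simp
  ring

lemma abs_deriv_heatKernel_two_mul_le {t₀ t : ℝ} (ht₀ : 0 < t₀) (ht : t₀ ≤ t) (w : 𝔼) :
    |(d / (4 * t) - ‖w‖ ^ 2 / (16 * t ^ 2)) * heatKernel d (2 * t) w| ≤
      (d / (4 * t₀) + 1 / (2 * t₀)) * (4 * Real.pi * (2 * t₀)) ^ (-(d : ℝ)/2) := by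
  have ht' : 0 < t := ht₀.trans_le ht
  have h1 := mul_exp_neg_mul_le one_pos (‖w‖ ^ 2 / (4 * (2 * t)))
  set e := Real.exp (-1 * (‖w‖ ^ 2 / (4 * (2 * t)))) with he
  have he0 : 0 < e := Real.exp_pos _
  have he1 : e ≤ 1 := Real.exp_le_one_iff.2 (by
    have : 0 ≤ ‖w‖ ^ 2 / (4 * (2 * t)) := by positivity
    linarith)
  have hG : heatKernel d (2 * t) w = (4 * Real.pi * (2 * t)) ^ (-(d : ℝ)/2) * e := by
    rw [heatKernel, he]; congr 2; ring
  have hA : (4 * Real.pi * (2 * t)) ^ (-(d : ℝ)/2) ≤ (4 * Real.pi * (2 * t₀)) ^ (-(d : ℝ)/2) := by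
    apply Real.rpow_le_rpow_of_nonpos (by positivity) (by gcongr)
    rw [neg_div, neg_nonpos]; positivity
  rw [hG]
  calc _ = |(d / (4 * t)) * e - (1 / (2 * t)) * (‖w‖ ^ 2 / (4 * (2 * t)) * e)| *
        (4 * Real.pi * (2 * t)) ^ (-(d : ℝ)/2) := by
          have hpos : 0 < (4 * Real.pi * (2 * t)) ^ (-(d : ℝ)/2) := by positivity
          rw [← mul_assoc, mul_right_comm, abs_mul _ (_ ^ _), abs_of_pos hpos]
          congr 2
          field_simp
          ring
    _ ≤ (d / (4 * t) + 1 / (2 * t)) * (4 * Real.pi * (2 * t₀)) ^ (-(d : ℝ)/2) := by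
          gcongr
          refine (abs_sub _ _).trans ?_
          rw [abs_of_nonneg (by positivity), abs_of_nonneg (by positivity)]
          have h3 : (d : ℝ) / (4 * t) * e ≤ d / (4 * t) * 1 := by gcongr
          have h4 : 1 / (2 * t) * (‖w‖ ^ 2 / (4 * (2 * t)) * e) ≤ 1 / (2 * t) * 1 := by
            gcongr; simpa using h1
          linarith
    _ ≤ _ := by gcongr

/-- The energy `‖T_t h‖² / 2`, written as a quadratic form with kernel `G_{2t}`. -/
noncomputable def heatEnergy (h : 𝔼 → V) (t : ℝ) : ℝ :=
  1 / 2 * ∫ p : 𝔼 × 𝔼, heatKernel d (2 * t) (p.1 - p.2) * inner ℝ (h p.1) (h p.2)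

lemma hasDerivAt_heatEnergy [CompleteSpace V] {t : ℝ} (ht : 0 < t) {h : 𝔼 → V}
    (hh : Integrable h) : HasDerivAt (heatEnergy h) (-∫ x, heatGradSq t h x) t := by
  have hi := integrable_inner_prod hh
  set C := (d / (4 * (t / 2)) + 1 / (2 * (t / 2))) *
    (4 * Real.pi * (2 * (t / 2))) ^ (-(d : ℝ)/2)
  have key := (hasDerivAt_integral_of_dominated_loc_of_deriv_le (𝕜 := ℝ) (x₀ := t)
    (μ := (volume : Measure (𝔼 × 𝔼)))
    (F := fun t (p : 𝔼 × 𝔼) => heatKernel d (2 * t) (p.1 - p.2) * inner ℝ (h p.1) (h p.2))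
    (F' := fun t (p : 𝔼 × 𝔼) => -2 * ((d / (4 * t) - ‖p.1 - p.2‖ ^ 2 / (16 * t ^ 2)) *
      heatKernel d (2 * t) (p.1 - p.2)) * inner ℝ (h p.1) (h p.2))
    (bound := fun p => 2 * C * ‖inner ℝ (h p.1) (h p.2)‖)
    (Ioi_mem_nhds (half_lt_self ht)) (Filter.Eventually.of_forall fun c =>
      (Continuous.aestronglyMeasurable (by fun_prop)).mul hi.1)
    (hi.bdd_mul (c := (4 * Real.pi * (2 * t)) ^ (-(d : ℝ)/2))
      (Continuous.aestronglyMeasurable (by fun_prop))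
      (Filter.Eventually.of_forall fun p => ?_))
    ((Continuous.aestronglyMeasurable (by fun_prop)).mul hi.1)
    (Filter.Eventually.of_forall fun p c hc => ?_) (hi.norm.const_mul _)
    (Filter.Eventually.of_forall fun p c hc => ?_)).2
  · refine (key.const_mul (1 / 2)).congr_deriv ?_
    rw [integral_heatGradSq ht hh, ← integral_const_mul, ← integral_neg]
    congr 1
    ext p
    ring
  · rw [Real.norm_of_nonneg (heatKernel_nonneg (by positivity) _)]
    exact heatKernel_le (by positivity) _
  · rw [norm_mul, norm_mul]
    refine mul_le_mul_of_nonneg_right ?_ (norm_nonneg _)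
    norm_num only [norm_neg, Real.norm_ofNat]
    exact mul_le_mul_of_nonneg_left (abs_deriv_heatKernel_two_mul_le (half_pos ht) (le_of_lt hc) _)
      two_pos.le
  · exact (hasDerivAt_heatKernel_two_mul ((half_pos ht).trans hc) _).mul_const _

lemma abs_heatEnergy_le {t : ℝ} (ht : 0 < t) {h : 𝔼 → V}
    (hh2 : Integrable fun x => ‖h x‖ ^ 2) :
    |heatEnergy h t| ≤ 1 / 2 * ∫ x, ‖h x‖ ^ 2 := by
  have ht2 : 0 < 2 * t := by positivity
  have h1 : Integrable fun p : 𝔼 × 𝔼 => ‖h p.2‖ ^ 2 * heatKernel d (2 * t) (p.1 - p.2) :=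
    Integrable.convolution_integrand (ContinuousLinearMap.mul ℝ ℝ) hh2 (integrable_heatKernel ht2)
  have h2 : Integrable fun p : 𝔼 × 𝔼 => ‖h p.1‖ ^ 2 * heatKernel d (2 * t) (p.1 - p.2) := by
    refine h1.swap.congr (Filter.Eventually.of_forall fun p => ?_)
    simp only [Function.comp, Prod.swap]
    rw [← heatKernel_neg, neg_sub]
  have e2 : ∫ p : 𝔼 × 𝔼, ‖h p.1‖ ^ 2 * heatKernel d (2 * t) (p.1 - p.2) = ∫ x, ‖h x‖ ^ 2 := by
    rw [Measure.volume_eq_prod, integral_prod _ h2]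
    simp_rw [integral_const_mul,
      fun y : 𝔼 => integral_sub_left_eq_self (heatKernel d (2 * t)) volume y,
      integral_heatKernel ht2, mul_one]
  have e1 : ∫ p : 𝔼 × 𝔼, ‖h p.2‖ ^ 2 * heatKernel d (2 * t) (p.1 - p.2) = ∫ x, ‖h x‖ ^ 2 := by
    rw [Measure.volume_eq_prod, integral_prod_symm _ h1]
    simp_rw [integral_const_mul,
      fun y : 𝔼 => integral_sub_right_eq_self (μ := volume)
        (heatKernel d (2 * t)) y,
      integral_heatKernel ht2, mul_one]
  rw [heatEnergy, abs_mul, abs_of_pos (by norm_num : (0:ℝ) < 1 / 2)]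
  gcongr
  calc |∫ p : 𝔼 × 𝔼, heatKernel d (2 * t) (p.1 - p.2) * inner ℝ (h p.1) (h p.2)| ≤
      ∫ p : 𝔼 × 𝔼, 1 / 2 * (‖h p.1‖ ^ 2 * heatKernel d (2 * t) (p.1 - p.2) +
        ‖h p.2‖ ^ 2 * heatKernel d (2 * t) (p.1 - p.2)) := by
          rw [← Real.norm_eq_abs]
          refine norm_integral_le_of_norm_le ((h2.add h1).const_mul _)
            (Filter.Eventually.of_forall fun p => ?_)
          have hG := heatKernel_nonneg ht2 (p.1 - p.2)
          rw [norm_mul, Real.norm_of_nonneg hG]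
          have h3 := norm_inner_le_norm (𝕜 := ℝ) (h p.1) (h p.2)
          have h4 : ‖inner ℝ (h p.1) (h p.2)‖ ≤ 1 / 2 * (‖h p.1‖ ^ 2 + ‖h p.2‖ ^ 2) := by
            nlinarith [sq_nonneg (‖h p.1‖ - ‖h p.2‖)]
          calc _ ≤ heatKernel d (2 * t) (p.1 - p.2) * (1 / 2 * (‖h p.1‖ ^ 2 + ‖h p.2‖ ^ 2)) := by
                gcongr
            _ = _ := by ring
    _ = _ := by
          rw [integral_const_mul, integral_add h2 h1, e1, e2]; ring

/-- The `L²` energy inequality for the heat semigroup. -/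
lemma lintegral_heatGradSq_le [CompleteSpace V] {h : 𝔼 → V} (hh : Integrable h)
    (hh2 : Integrable fun x => ‖h x‖ ^ 2) :
    ∫⁻ t in Set.Ioi (0 : ℝ), ∫⁻ x, ENNReal.ofReal (heatGradSq t h x) ≤
      ∫⁻ x, ENNReal.ofReal (‖h x‖ ^ 2) := by
  have hfin : ∀ a b : ℝ, 0 < a → a ≤ b →
      ∫⁻ t in Set.Ioc a b, ∫⁻ x, ENNReal.ofReal (heatGradSq t h x) ≤
        ∫⁻ x, ENNReal.ofReal (‖h x‖ ^ 2) := by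
    intro a b ha hab
    have hd : ∀ t, a ≤ t → HasDerivAt (fun t => -heatEnergy h t) (∫ x, heatGradSq t h x) t :=
      fun t ht => (hasDerivAt_heatEnergy (ha.trans_le ht) hh).neg.congr_deriv (neg_neg _)
    have hcont : ContinuousOn (fun t => -heatEnergy h t) (Set.Icc a b) := fun t ht =>
      (hd t ht.1).continuousAt.continuousWithinAt
    have h0 : ∀ t, 0 ≤ ∫ x, heatGradSq t h x := fun t =>
      integral_nonneg fun x => heatGradSq_nonneg t h x
    have hint := intervalIntegral.integrableOn_deriv_of_nonneg hcont
      (fun t ht => hd t ht.1.le) (fun t _ => h0 t)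
    have hFTC := intervalIntegral.integral_eq_sub_of_hasDerivAt_of_le hab hcont
      (fun t ht => hd t ht.1.le) ((intervalIntegrable_iff_integrableOn_Ioc_of_le hab).2 hint)
    rw [intervalIntegral.integral_of_le hab] at hFTC
    calc _ = ∫⁻ t in Set.Ioc a b, ENNReal.ofReal (∫ x, heatGradSq t h x) := by
          refine setLIntegral_congr_fun measurableSet_Ioc fun t ht => ?_
          exact (ofReal_integral_eq_lintegral_ofReal (integrable_heatGradSq (ha.trans ht.1) hh)
            (Filter.Eventually.of_forall fun x => heatGradSq_nonneg t h x)).symm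
      _ = ENNReal.ofReal (∫ t in Set.Ioc a b, ∫ x, heatGradSq t h x) :=
          (ofReal_integral_eq_lintegral_ofReal hint (Filter.Eventually.of_forall h0)).symm
      _ ≤ ENNReal.ofReal (∫ x, ‖h x‖ ^ 2) := by
          refine ENNReal.ofReal_le_ofReal ?_
          rw [hFTC]
          have h1 := (abs_le.1 (abs_heatEnergy_le ha hh2)).2
          have h2 := (abs_le.1 (abs_heatEnergy_le (ha.trans_le hab) hh2)).1
          linarith
      _ = _ := ofReal_integral_eq_lintegral_ofReal hh2
          (Filter.Eventually.of_forall fun x => sq_nonneg _)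
  have hU : Set.Ioi (0 : ℝ) = ⋃ n : ℕ, Set.Ioc (1 / ((n : ℝ) + 1)) ((n : ℝ) + 1) := by
    ext t
    simp only [Set.mem_Ioi, Set.mem_iUnion, Set.mem_Ioc]
    constructor
    · intro ht
      obtain ⟨n, hn⟩ := exists_nat_one_div_lt ht
      obtain ⟨m, hm⟩ := exists_nat_ge t
      refine ⟨max n m, ?_, ?_⟩
      · refine lt_of_le_of_lt ?_ hn
        gcongr; exact le_max_left _ _
      · have : (m : ℝ) ≤ (max n m : ℕ) := by exact_mod_cast le_max_right _ _
        linarith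
    · rintro ⟨n, hn, -⟩
      exact lt_trans (by positivity) hn
  have hmono : Monotone fun n : ℕ => Set.Ioc (1 / ((n : ℝ) + 1)) ((n : ℝ) + 1) := by
    intro m n hmn
    have : (m : ℝ) ≤ n := by exact_mod_cast hmn
    exact Set.Ioc_subset_Ioc (by gcongr) (by gcongr)
  rw [hU, setLIntegral_iUnion_of_directed _ hmono.directed_le]
  refine iSup_le fun n => hfin _ _ (by positivity) ?_
  have : (0 : ℝ) ≤ n := Nat.cast_nonneg n
  rw [div_le_iff₀ (by positivity)]
  nlinarith

end HeatKernel

lemma measurable_heatGradSq {d : ℕ} {V : Type*} [NormedAddCommGroup V]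
    [InnerProductSpace ℝ V] {f : ℝ → EuclideanSpace ℝ (Fin d) → ℝ → V}
    (hf : StronglyMeasurable
      (fun q : ℝ × EuclideanSpace ℝ (Fin d) × ℝ => f q.1 q.2.1 q.2.2)) :
    Measurable fun q : (ℝ × ℝ × EuclideanSpace ℝ (Fin d)) × ℝ =>
      heatGradSq (q.1.2.1 - q.1.1) (fun y => f q.1.1 y q.2) q.1.2.2 := by
  refine Finset.measurable_sum _ fun j _ => ?_
  refine StronglyMeasurable.measurable ?_
  refine (StronglyMeasurable.integral_prod_right (E := V) ?_).norm.pow 2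
  refine StronglyMeasurable.smul (Measurable.stronglyMeasurable ?_) ?_
  · exact (measurable_heatKernelDeriv j).comp (g := fun p : ℝ × EuclideanSpace ℝ (Fin d) =>
      heatKernelDeriv p.1 j p.2)
      (f := fun r : ((ℝ × ℝ × EuclideanSpace ℝ (Fin d)) × ℝ) × EuclideanSpace ℝ (Fin d) =>
        (r.1.1.2.1 - r.1.1.1, r.1.1.2.2 - r.2)) (by fun_prop)
  · exact hf.comp_measurable
      (g := fun r : ((ℝ × ℝ × EuclideanSpace ℝ (Fin d)) × ℝ) × EuclideanSpace ℝ (Fin d) =>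
        (r.1.1.1, r.2, r.1.2)) (by fun_prop)

lemma lintegral_Ioi_sub (φ : ℝ → ℝ≥0∞) (s : ℝ) :
    ∫⁻ t in Set.Ioi s, φ (t - s) = ∫⁻ t in Set.Ioi 0, φ t := by
  rw [← lintegral_indicator measurableSet_Ioi, ← lintegral_indicator measurableSet_Ioi,
    ← lintegral_sub_right_eq_self ((Set.Ioi (0 : ℝ)).indicator φ) s]
  congr 1
  ext t
  simp [Set.indicator]

/-- Tonelli's theorem on the region `s < t`. -/
lemma lintegral_lintegral_Iio_swap {X : Type*} [MeasureSpace X] [SFinite (volume : Measure X)]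
    {Q : ℝ → ℝ × X → ℝ≥0∞} (hQ : Measurable (Function.uncurry Q)) :
    ∫⁻ x, ∫⁻ t, ∫⁻ s in Set.Iio t, Q s (t, x) =
      ∫⁻ s, ∫⁻ p, Q s p ∂((volume.restrict (Set.Ioi s)).prod volume) := by
  have hm1 : Measurable fun r : (X × ℝ) × ℝ =>
      (Set.Iio r.1.2).indicator (fun s => Q s (r.1.2, r.1.1)) r.2 := by
    have hset : MeasurableSet {r : (X × ℝ) × ℝ | r.2 < r.1.2} :=
      measurableSet_lt (by fun_prop) (by fun_prop)
    exact Measurable.indicator (hQ.comp (by fun_prop : Measurable fun r : (X × ℝ) × ℝ =>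
      (r.2, (r.1.2, r.1.1)))) hset
  simp_rw [← lintegral_indicator measurableSet_Iio]
  calc _ = ∫⁻ x, ∫⁻ s, ∫⁻ t, (Set.Iio t).indicator (fun s => Q s (t, x)) s :=
        lintegral_congr fun x => lintegral_lintegral_swap
          (hm1.comp (by fun_prop : Measurable fun r : ℝ × ℝ => ((x, r.1), r.2))).aemeasurable
    _ = ∫⁻ s, ∫⁻ x, ∫⁻ t, (Set.Iio t).indicator (fun s => Q s (t, x)) s := by
        refine lintegral_lintegral_swap (Measurable.aemeasurable ?_)
        exact Measurable.lintegral_prod_right' (hm1.comp (by fun_prop : Measurable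
          fun r : (X × ℝ) × ℝ => ((r.1.1, r.2), r.1.2)))
    _ = _ := by
        refine lintegral_congr fun s => ?_
        rw [lintegral_prod_symm' (fun p => Q s p)
          (hQ.comp (by fun_prop : Measurable fun p : ℝ × X => (s, p)))]
        refine lintegral_congr fun x => ?_
        rw [← lintegral_indicator measurableSet_Ioi]
        rfl

lemma integrable_sq_norm_of_hasCompactSupport {d : ℕ} {V : Type*} [NormedAddCommGroup V]
    {h : EuclideanSpace ℝ (Fin d) → V} (hc : Continuous h) (hs : HasCompactSupport h) :
    Integrable fun y => ‖h y‖ ^ 2 := by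
  have hc2 : Continuous fun y => ‖h y‖ ^ 2 := by fun_prop
  have hs2 : HasCompactSupport fun y => ‖h y‖ ^ 2 :=
    hs.mono fun y hy h0 => hy (by simp [h0])
  exact hc2.integrable_of_hasCompactSupport hs2

lemma lintegral_rpow_lintegral_heatGradSq_le {d : ℕ} {V : Type*} [NormedAddCommGroup V]
    [InnerProductSpace ℝ V] [CompleteSpace V] {H : ℝ} (hH : 1 / 2 < H)
    {f : ℝ → EuclideanSpace ℝ (Fin d) → ℝ → V}
    (hf : StronglyMeasurable
      (fun q : ℝ × EuclideanSpace ℝ (Fin d) × ℝ => f q.1 q.2.1 q.2.2)) (s : ℝ)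
    (hint : ∀ θ, Integrable fun y => f s y θ)
    (hint2 : ∀ θ, Integrable fun y => ‖f s y θ‖ ^ 2) (S : Set ℝ) :
    ∫⁻ p, (∫⁻ θ in S, ENNReal.ofReal
        ((heatGradSq (p.1 - s) (fun y => f s y θ) p.2) ^ (1 / (2 * H)))) ^ (2 * H)
        ∂((volume.restrict (Set.Ioi s)).prod volume) ≤
      (∫⁻ θ in S, (∫⁻ x, ENNReal.ofReal (‖f s x θ‖ ^ 2)) ^ (1 / (2 * H))) ^ (2 * H) := by
  have hH0 : 0 < 2 * H := by linarith
  have hms : Measurable (Function.uncurry fun (p : ℝ × EuclideanSpace ℝ (Fin d)) θ =>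
      ENNReal.ofReal ((heatGradSq (p.1 - s) (fun y => f s y θ) p.2) ^ (1 / (2 * H)))) :=
    (((measurable_heatGradSq hf).comp (by fun_prop : Measurable fun
      r : (ℝ × EuclideanSpace ℝ (Fin d)) × ℝ => ((s, r.1), r.2))).pow_const _).ennreal_ofReal
  refine (lintegral_rpow_lintegral_le (by linarith) hms).trans ?_
  gcongr with θ
  have hpow : ∀ p : ℝ × EuclideanSpace ℝ (Fin d), (ENNReal.ofReal
      ((heatGradSq (p.1 - s) (fun y => f s y θ) p.2) ^ (1 / (2 * H)))) ^ (2 * H) =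
      ENNReal.ofReal (heatGradSq (p.1 - s) (fun y => f s y θ) p.2) := fun p => by
    have h0 := heatGradSq_nonneg (p.1 - s) (fun y => f s y θ) p.2
    rw [ENNReal.ofReal_rpow_of_nonneg (by positivity) hH0.le, ← Real.rpow_mul h0,
      one_div_mul_cancel hH0.ne', Real.rpow_one]
  simp only [hpow]
  have hm2 : Measurable fun p : ℝ × EuclideanSpace ℝ (Fin d) =>
      ENNReal.ofReal (heatGradSq (p.1 - s) (fun y => f s y θ) p.2) :=
    ((measurable_heatGradSq hf).comp (by fun_prop : Measurable fun
      p : ℝ × EuclideanSpace ℝ (Fin d) => ((s, p), θ))).ennreal_ofReal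
  rw [lintegral_prod _ hm2.aemeasurable, lintegral_Ioi_sub fun t =>
    ∫⁻ x, ENNReal.ofReal (heatGradSq t (fun y => f s y θ) x)]
  exact lintegral_heatGradSq_le (hint θ) (hint2 θ)

/-- The `p = 2` case of the generalized Littlewood–Paley inequality for
`L^{1/H}((α,β);V)`-valued functions: there is a constant `N = N(d)` such that for
every `H ∈ (1/2,1)`, every separable Hilbert space `V`, every `-∞ ≤ α < β ≤ ∞`, and
every jointly measurable `f(t,x,θ)`, smooth with compact support in `(t,x)`,
`∫_{ℝ^d} ∫_{-∞}^∞ ∫_{-∞}^t (∫_α^β ‖∇T_{t-s}f(s,·,θ)(x)‖^{1/H} dθ)^{2H} ds dt dx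
  ≤ N ∫_{-∞}^∞ [∫_α^β (∫_{ℝ^d} ‖f(t,x,θ)‖² dx)^{1/(2H)} dθ]^{2H} dt`. -/
theorem littlewood_paley_LH_valued_p_two (d : ℕ) (hd : 1 ≤ d) :
    ∃ N : ℝ, 0 < N ∧
      ∀ (H : ℝ), H ∈ Set.Ioo (1/2 : ℝ) 1 →
      ∀ (V : Type) [NormedAddCommGroup V] [InnerProductSpace ℝ V] [CompleteSpace V]
        [TopologicalSpace.SeparableSpace V]
        (α β : EReal), α < β →
      ∀ (f : ℝ → EuclideanSpace ℝ (Fin d) → ℝ → V),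
        StronglyMeasurable
          (fun q : ℝ × EuclideanSpace ℝ (Fin d) × ℝ => f q.1 q.2.1 q.2.2) →
        (∀ θ, ContDiff ℝ (⊤ : ℕ∞)
          (fun q : ℝ × EuclideanSpace ℝ (Fin d) => f q.1 q.2 θ)) →
        (∃ K : Set (ℝ × EuclideanSpace ℝ (Fin d)), IsCompact K ∧
          ∀ θ, tsupport (fun q : ℝ × EuclideanSpace ℝ (Fin d) => f q.1 q.2 θ) ⊆ K) →
        (∫⁻ x : EuclideanSpace ℝ (Fin d), ∫⁻ t : ℝ,
            ∫⁻ s in Set.Iio t,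
              (∫⁻ θ in {θ : ℝ | α < (θ : EReal) ∧ (θ : EReal) < β},
                ENNReal.ofReal
                  ((gradHeatNormSq d (t - s) (fun y => f s y θ) x) ^ (1/(2*H))))
                ^ (2*H))
          ≤ ENNReal.ofReal N *
            ∫⁻ t : ℝ,
              (∫⁻ θ in {θ : ℝ | α < (θ : EReal) ∧ (θ : EReal) < β},
                (∫⁻ x : EuclideanSpace ℝ (Fin d),
                  ENNReal.ofReal (‖f t x θ‖ ^ 2)) ^ (1/(2*H))) ^ (2*H) := by
  refine ⟨1, one_pos, fun H hH V _ _ _ _ α β _ f hf hsmooth ⟨K, hK, hsupp⟩ => ?_⟩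
  set S : Set ℝ := {θ : ℝ | α < (θ : EReal) ∧ (θ : EReal) < β}
  have hcont : ∀ s θ, Continuous fun y => f s y θ := fun s θ =>
    (hsmooth θ).continuous.comp (by fun_prop : Continuous fun y => (s, y))
  have hcs : ∀ s θ, HasCompactSupport fun y => f s y θ := fun s θ =>
    HasCompactSupport.intro (hK.image continuous_snd) fun y hy => by
      by_contra hne
      exact hy ⟨(s, y), hsupp θ (subset_tsupport _ hne), rfl⟩
  have hint : ∀ s θ, Integrable fun y => f s y θ := fun s θ =>
    (hcont s θ).integrable_of_hasCompactSupport (hcs s θ)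
  have hint2 : ∀ s θ, Integrable fun y => ‖f s y θ‖ ^ 2 := fun s θ =>
    integrable_sq_norm_of_hasCompactSupport (hcont s θ) (hcs s θ)
  set Q : ℝ → ℝ × EuclideanSpace ℝ (Fin d) → ℝ≥0∞ := fun s p =>
    (∫⁻ θ in S, ENNReal.ofReal
      ((heatGradSq (p.1 - s) (fun y => f s y θ) p.2) ^ (1 / (2 * H)))) ^ (2 * H) with hQdef
  have hm : Measurable fun q : (ℝ × ℝ × EuclideanSpace ℝ (Fin d)) × ℝ => ENNReal.ofReal
      ((heatGradSq (q.1.2.1 - q.1.1) (fun y => f q.1.1 y q.2) q.1.2.2) ^ (1 / (2 * H))) :=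
    ((measurable_heatGradSq hf).pow_const _).ennreal_ofReal
  have hQ : Measurable (Function.uncurry Q) :=
    (Measurable.lintegral_prod_right' (ν := volume.restrict S) hm).pow_const _
  calc _ = ∫⁻ x, ∫⁻ t, ∫⁻ s in Set.Iio t, Q s (t, x) := by
        refine lintegral_congr fun x => lintegral_congr fun t =>
          setLIntegral_congr_fun measurableSet_Iio fun s hs => ?_
        simp only [hQdef]
        congr 1
        refine lintegral_congr fun θ => ?_
        rw [gradHeatNormSq_eq (sub_pos.2 hs) (hint s θ)]
    _ = ∫⁻ s, ∫⁻ p, Q s p ∂((volume.restrict (Set.Ioi s)).prod volume) :=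
        lintegral_lintegral_Iio_swap hQ
    _ ≤ ∫⁻ s, (∫⁻ θ in S, (∫⁻ x, ENNReal.ofReal (‖f s x θ‖ ^ 2)) ^ (1 / (2 * H))) ^ (2 * H) :=
        lintegral_mono fun s =>
          lintegral_rpow_lintegral_heatGradSq_le hH.1 hf s (hint s) (hint2 s) S
    _ = _ := by simp
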